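/- arXiv:1512.04702 — 2 statements merged into one kernel-verified Lean document; each statement's English description precedes it below -/
import Mathlib

section
/- Under the stated hypotheses, and assuming additionally that β(t) → +∞ as t → +∞, there exists x_∞ ∈ S such that x(t) converges weakly to x_∞ as t → +∞. -/
open Filter MeasureTheory Set RealInnerProductSpace

section RealLine

theorem antitoneOn_Ici_of_hasDerivWithinAt {f f' : ℝ → ℝ} {a : ℝ} (ha : 0 ≤ a)
    (hf : ∀ t ∈ Ici (0 : ℝ), HasDerivWithinAt f (f' t) (Ici 0) t)
    (hf' : ∀ t ∈ Ici a, f' t ≤ 0) : AntitoneOn f (Ici a) := by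
  have hsub : Ici a ⊆ Ici (0 : ℝ) := Ici_subset_Ici.2 ha
  refine antitoneOn_of_hasDerivWithinAt_nonpos (convex_Ici a)
    (fun t ht => ((hf t (hsub ht)).mono hsub).continuousWithinAt) (fun t ht => ?_)
    (fun t ht => hf' t (interior_subset ht))
  exact (hf t (hsub (interior_subset ht))).mono (interior_subset.trans hsub)

theorem AntitoneOn.exists_tendsto_atTop {f : ℝ → ℝ} {m : ℝ} (hf : AntitoneOn f (Ici 0))
    (hm : ∀ t ∈ Ici (0 : ℝ), m ≤ f t) : ∃ l, Tendsto f atTop (nhds l) := by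
  have hanti : Antitone fun t => f (max t 0) := fun s t hst =>
    hf (le_max_right s 0) (le_max_right t 0) (max_le_max_right 0 hst)
  have hbdd : BddBelow (range fun t => f (max t 0)) :=
    ⟨m, by rintro _ ⟨t, rfl⟩; exact hm _ (le_max_right t 0)⟩
  refine ⟨_, (tendsto_atTop_ciInf hanti hbdd).congr' ?_⟩
  filter_upwards [eventually_ge_atTop 0] with t ht
  rw [max_eq_left ht]

theorem exists_tendsto_of_deriv_le_integrable {f f' G g : ℝ → ℝ} {m M : ℝ}
    (hf : ∀ t ∈ Ici (0 : ℝ), HasDerivWithinAt f (f' t) (Ici 0) t)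
    (hG : ∀ t ∈ Ici (0 : ℝ), HasDerivWithinAt G (g t) (Ici 0) t)
    (hg : ∀ t ∈ Ici (0 : ℝ), 0 ≤ g t) (hM : ∀ t ∈ Ici (0 : ℝ), G t ≤ M)
    (hfg : ∀ t ∈ Ici (0 : ℝ), f' t ≤ g t) (hm : ∀ t ∈ Ici (0 : ℝ), m ≤ f t) :
    ∃ l, Tendsto f atTop (nhds l) := by
  obtain ⟨l₁, h₁⟩ := (antitoneOn_Ici_of_hasDerivWithinAt le_rfl
    (fun t ht => (hf t ht).sub (hG t ht))
    (fun t ht => sub_nonpos.2 (hfg t ht))).exists_tendsto_atTop (m := m - M)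
    (fun t ht => sub_le_sub (hm t ht) (hM t ht))
  obtain ⟨l₂, h₂⟩ := (antitoneOn_Ici_of_hasDerivWithinAt le_rfl (fun t ht => (hG t ht).neg)
    (fun t ht => neg_nonpos.2 (hg t ht))).exists_tendsto_atTop (m := -M)
    (fun t ht => neg_le_neg (hM t ht))
  refine ⟨l₁ - l₂, (h₁.sub h₂).congr fun t => ?_⟩
  simp

theorem exists_hasDerivWithinAt_Ici {f : ℝ → ℝ} (hf : ContinuousOn f (Ici 0)) :
    ∃ F : ℝ → ℝ, (∀ t ∈ Ici (0 : ℝ), HasDerivWithinAt F (f t) (Ici 0) t) ∧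
      ∀ t ∈ Ici (0 : ℝ), F t = ∫ s in (0 : ℝ)..t, f s := by
  have hc : Continuous fun t => f (max t 0) :=
    hf.comp_continuous (by fun_prop) fun t => le_max_right t 0
  refine ⟨fun t => ∫ s in (0 : ℝ)..t, f (max s 0), fun t ht => ?_, fun t ht => ?_⟩
  · have := (hc.integral_hasStrictDerivAt 0 t).hasDerivAt.hasDerivWithinAt (s := Ici 0)
    rwa [max_eq_left ht] at this
  · refine intervalIntegral.integral_congr fun s hs => ?_
    rw [uIcc_of_le ht] at hs
    simp only [max_eq_left hs.1]

theorem exists_bounded_primitive {f : ℝ → ℝ} (hf : ContinuousOn f (Ici 0))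
    (h0 : ∀ t ∈ Ici (0 : ℝ), 0 ≤ f t) (hint : ∫⁻ t in Ici (0 : ℝ), ENNReal.ofReal (f t) ≠ ⊤) :
    ∃ (F : ℝ → ℝ) (M : ℝ), (∀ t ∈ Ici (0 : ℝ), HasDerivWithinAt F (f t) (Ici 0) t) ∧
      ∀ t ∈ Ici (0 : ℝ), F t ≤ M := by
  obtain ⟨F, hF, hFint⟩ := exists_hasDerivWithinAt_Ici hf
  have hnn : 0 ≤ᵐ[volume.restrict (Ici (0 : ℝ))] f :=
    (ae_restrict_iff' measurableSet_Ici).2 (Eventually.of_forall h0)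
  have hI : IntegrableOn f (Ici 0) :=
    (lintegral_ofReal_ne_top_iff_integrable (hf.aestronglyMeasurable measurableSet_Ici) hnn).1 hint
  refine ⟨F, ∫ s in Ici (0 : ℝ), f s, hF, fun t ht => ?_⟩
  rw [hFint t ht, intervalIntegral.integral_of_le ht]
  exact setIntegral_mono_set hI hnn
    (LE.le.eventuallyLE fun s hs => hs.1.le)

/-- Grönwall-type bound for `h' + γ h ≤ γ a` at infinity. -/
theorem eventually_le_add_of_deriv_add_le {h h' : ℝ → ℝ} {γ a ε : ℝ} (hγ : 0 < γ) (hε : 0 < ε)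
    (hh : ∀ t ∈ Ici (0 : ℝ), HasDerivWithinAt h (h' t) (Ici 0) t)
    (hle : ∀ᶠ t in atTop, h' t + γ * h t ≤ γ * a) : ∀ᶠ t in atTop, h t ≤ a + ε := by
  obtain ⟨T, hT⟩ := eventually_atTop.1 (hle.and (eventually_ge_atTop 0))
  have hT0 : 0 ≤ T := (hT T le_rfl).2
  have hexp (t : ℝ) : HasDerivAt (fun t => Real.exp (γ * t)) (Real.exp (γ * t) * γ) t := by
    simpa using ((hasDerivAt_id t).const_mul γ).exp
  have hanti : AntitoneOn (fun t => Real.exp (γ * t) * (h t - a)) (Ici T) := by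
    refine antitoneOn_Ici_of_hasDerivWithinAt hT0
      (fun t ht => (hexp t).hasDerivWithinAt.mul ((hh t ht).sub_const a)) fun t ht => ?_
    have := mul_nonneg (Real.exp_pos (γ * t)).le (sub_nonneg.2 (hT t ht).1)
    linarith
  have hlim : Tendsto (fun t => ε * Real.exp (γ * t)) atTop atTop :=
    (Real.tendsto_exp_atTop.comp (tendsto_id.const_mul_atTop hγ)).const_mul_atTop hε
  filter_upwards [hlim.eventually_ge_atTop (Real.exp (γ * T) * (h T - a)),
    eventually_ge_atTop T] with t ht htT
  have h1 := (hanti self_mem_Ici htT htT).trans ht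
  have h2 : Real.exp (γ * t) * (h t - a) ≤ Real.exp (γ * t) * ε := by
    simpa [mul_comm] using h1
  linarith [le_of_mul_le_mul_left h2 (Real.exp_pos _)]

theorem tendsto_div_of_deriv_add_tendsto {h h' : ℝ → ℝ} {γ l : ℝ} (hγ : 0 < γ)
    (hh : ∀ t ∈ Ici (0 : ℝ), HasDerivWithinAt h (h' t) (Ici 0) t)
    (hl : Tendsto (fun t => h' t + γ * h t) atTop (nhds l)) :
    Tendsto h atTop (nhds (l / γ)) := by
  have hγl : γ * (l / γ) = l := by field_simp
  refine Metric.tendsto_nhds.2 fun ε hε => ?_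
  have hup : ∀ᶠ t in atTop, h' t + γ * h t ≤ γ * (l / γ + ε / 3) := by
    have : l < γ * (l / γ + ε / 3) := by rw [mul_add, hγl]; linarith [mul_pos hγ hε]
    exact (hl.eventually_lt_const this).mono fun t ht => ht.le
  have hlo : ∀ᶠ t in atTop, -h' t + γ * -h t ≤ γ * (-(l / γ) + ε / 3) := by
    have : l - γ * (ε / 3) < l := by linarith [mul_pos hγ hε]
    filter_upwards [hl.eventually_const_lt this] with t ht
    rw [mul_add, mul_neg, mul_neg, hγl]
    linarith
  have hε3 : 0 < ε / 3 := by positivity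
  filter_upwards [eventually_le_add_of_deriv_add_le hγ hε3 hh hup,
    eventually_le_add_of_deriv_add_le hγ hε3 (fun t ht => (hh t ht).neg) hlo] with t h1 h2
  rw [Pi.neg_apply] at h2
  rw [Real.dist_eq, abs_lt]
  constructor <;> linarith

/-- Lyapunov analysis along a trajectory: `h` plays the role of `‖x - z‖² / 2`, `v` of `‖ẋ‖²`,
and `W` of the energy relative to the target `z`. -/
theorem lyapunov_tendsto {h h' h'' v W W' G g : ℝ → ℝ} {γ μ δ c m M : ℝ}
    (hγ : 0 < γ) (hμ : 0 < μ) (hδ : 0 < δ) (hc : 0 < c)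
    (hh : ∀ t ∈ Ici (0 : ℝ), HasDerivWithinAt h (h' t) (Ici 0) t)
    (hh' : ∀ t ∈ Ici (0 : ℝ), HasDerivWithinAt h' (h'' t) (Ici 0) t)
    (hW : ∀ t ∈ Ici (0 : ℝ), HasDerivWithinAt W (W' t) (Ici 0) t)
    (hG : ∀ t ∈ Ici (0 : ℝ), HasDerivWithinAt G (g t) (Ici 0) t)
    (hGM : ∀ t ∈ Ici (0 : ℝ), G t ≤ M)
    (hv : ContinuousOn v (Ici 0))
    (hg0 : ∀ t ∈ Ici (0 : ℝ), 0 ≤ g t) (hv0 : ∀ t ∈ Ici (0 : ℝ), 0 ≤ v t)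
    (hh0 : ∀ t ∈ Ici (0 : ℝ), 0 ≤ h t)
    (hh'v : ∀ t ∈ Ici (0 : ℝ), -(v t + h t) ≤ h' t)
    (hq : ∀ t ∈ Ici (0 : ℝ), h'' t + γ * h' t ≤ 3 / 2 * v t - W t)
    (hqg : ∀ t ∈ Ici (0 : ℝ), μ * (h'' t + γ * h' t) ≤ μ * v t + g t)
    (hWg : ∀ t ∈ Ici (0 : ℝ), W' t + μ * (h'' t + γ * h' t) ≤ -(δ * v t) + g t)
    (hlow : ∀ t ∈ Ici (0 : ℝ), m + c * (v t + h t) ≤ W t + μ * (h' t + γ * h t)) :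
    (∃ l, Tendsto h atTop (nhds l)) ∧ ∃ l ≤ 0, Tendsto W atTop (nhds l) := by
  obtain ⟨V, hV, -⟩ := exists_hasDerivWithinAt_Ici hv
  have hqd : ∀ t ∈ Ici (0 : ℝ),
      HasDerivWithinAt (fun t => h' t + γ * h t) (h'' t + γ * h' t) (Ici 0) t :=
    fun t ht => (hh' t ht).add ((hh t ht).const_mul γ)
  have hFd : ∀ t ∈ Ici (0 : ℝ), HasDerivWithinAt (fun t => W t + μ * (h' t + γ * h t))
      (W' t + μ * (h'' t + γ * h' t)) (Ici 0) t :=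
    fun t ht => (hW t ht).add ((hqd t ht).const_mul μ)
  have hlow' : ∀ t ∈ Ici (0 : ℝ), m ≤ W t + μ * (h' t + γ * h t) := fun t ht =>
    le_trans (le_add_of_nonneg_right (mul_nonneg hc.le (add_nonneg (hv0 t ht) (hh0 t ht))))
      (hlow t ht)
  have hanti : AntitoneOn (fun t => W t + μ * (h' t + γ * h t) + δ * V t - G t) (Ici 0) :=
    antitoneOn_Ici_of_hasDerivWithinAt le_rfl
      (fun t ht => ((hFd t ht).add ((hV t ht).const_mul δ)).sub (hG t ht))
      (fun t ht => by linarith [hWg t ht])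
  have hVanti : AntitoneOn (fun t => -V t) (Ici 0) :=
    antitoneOn_Ici_of_hasDerivWithinAt le_rfl (fun t ht => (hV t ht).neg)
      (fun t ht => neg_nonpos.2 (hv0 t ht))
  obtain ⟨N, hN⟩ : ∃ N, ∀ t ∈ Ici (0 : ℝ), W t + μ * (h' t + γ * h t) + δ * V t ≤ N :=
    ⟨W 0 + μ * (h' 0 + γ * h 0) + δ * V 0 - G 0 + M, fun t ht => by
      have := hanti self_mem_Ici ht ht
      simp only at this
      linarith [hGM t ht]⟩
  have hVM : ∀ t ∈ Ici (0 : ℝ), V t ≤ (N - m) / δ := fun t ht => by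
    rw [le_div_iff₀ hδ]
    linarith [hN t ht, hlow' t ht]
  have hV0 : ∀ t ∈ Ici (0 : ℝ), V 0 ≤ V t := fun t ht =>
    neg_le_neg_iff.1 (hVanti self_mem_Ici ht ht)
  obtain ⟨lF, hlF⟩ := exists_tendsto_of_deriv_le_integrable hFd hG hg0 hGM
    (fun t ht => (hWg t ht).trans (by linarith [mul_nonneg hδ.le (hv0 t ht)])) hlow'
  have hqlow : ∀ t ∈ Ici (0 : ℝ), -((N - δ * V 0 - m) / c) ≤ h' t + γ * h t := fun t ht => by
    have h1 : v t + h t ≤ (N - δ * V 0 - m) / c := by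
      rw [le_div_iff₀ hc]
      linarith [hlow t ht, hN t ht, mul_le_mul_of_nonneg_left (hV0 t ht) hδ.le]
    linarith [hh'v t ht, mul_nonneg hγ.le (hh0 t ht)]
  obtain ⟨lq, hlq⟩ := exists_tendsto_of_deriv_le_integrable
    (f := fun t => μ * (h' t + γ * h t)) (G := fun t => μ * V t + G t)
    (M := μ * ((N - m) / δ) + M) (m := μ * -((N - δ * V 0 - m) / c))
    (fun t ht => (hqd t ht).const_mul μ)
    (fun t ht => ((hV t ht).const_mul μ).add (hG t ht))
    (fun t ht => add_nonneg (mul_nonneg hμ.le (hv0 t ht)) (hg0 t ht))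
    (fun t ht => add_le_add (mul_le_mul_of_nonneg_left (hVM t ht) hμ.le) (hGM t ht))
    hqg (fun t ht => mul_le_mul_of_nonneg_left (hqlow t ht) hμ.le)
  have hq_lim : Tendsto (fun t => h' t + γ * h t) atTop (nhds (lq / μ)) :=
    (hlq.div_const μ).congr fun t => by field_simp
  have hWlim : Tendsto W atTop (nhds (lF - lq)) :=
    (hlF.sub hlq).congr fun t => by ring
  refine ⟨⟨_, tendsto_div_of_deriv_add_tendsto hγ hh hq_lim⟩, lF - lq, ?_, hWlim⟩
  by_contra! hpos
  obtain ⟨T, hT⟩ := eventually_atTop.1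
    ((hWlim.eventually_const_lt (half_lt_self hpos)).and (eventually_ge_atTop 0))
  have hKanti : AntitoneOn
      (fun t => h' t + γ * h t - 3 / 2 * V t + (lF - lq) / 2 * t) (Ici T) := by
    refine antitoneOn_Ici_of_hasDerivWithinAt (hT T le_rfl).2
      (fun t ht => ((hqd t ht).sub ((hV t ht).const_mul (3 / 2))).add
        ((hasDerivWithinAt_id t _).const_mul ((lF - lq) / 2))) fun t ht => ?_
    linarith [hq t (hT t ht).2, (hT t ht).1]
  have hlin : Tendsto (fun t : ℝ => (lF - lq) / 2 * t) atTop atTop :=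
    tendsto_id.const_mul_atTop (half_pos hpos)
  obtain ⟨t, htb, htT⟩ := ((hlin.eventually_gt_atTop
    (h' T + γ * h T - 3 / 2 * V T + (lF - lq) / 2 * T + (N - δ * V 0 - m) / c
      + 3 / 2 * ((N - m) / δ))).and (eventually_ge_atTop T)).exists
  have h1 := hKanti self_mem_Ici htT htT
  simp only at h1
  linarith [hVM t (hT t htT).2, hqlow t (hT t htT).2]

end RealLine

section Convexity

variable {H : Type*} [NormedAddCommGroup H] [InnerProductSpace ℝ H] [CompleteSpace H]

theorem HasGradientAt.comp_hasDerivWithinAt {f : H → ℝ} {f' : H} {x : ℝ → H} {x' : H} {s : Set ℝ}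
    {t : ℝ} (hf : HasGradientAt f f' (x t)) (hx : HasDerivWithinAt x x' s t) :
    HasDerivWithinAt (fun t => f (x t)) ⟪f', x'⟫ s t := by
  have := hf.hasFDerivAt.comp_hasDerivWithinAt t hx
  rw [InnerProductSpace.toDual_apply_apply] at this
  exact this

theorem ConvexOn.add_inner_gradient_le {f : H → ℝ} (hf : ConvexOn ℝ univ f)
    (hd : Differentiable ℝ f) (a b : H) : f a + ⟪gradient f a, b - a⟫ ≤ f b := by
  have hline : HasDerivAt (fun s : ℝ => a + s • (b - a)) (b - a) 0 := by
    simpa using ((hasDerivAt_id (0 : ℝ)).smul_const (b - a)).const_add a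
  have hg : HasGradientAt f (gradient f a) (a + (0 : ℝ) • (b - a)) := by
    simpa using (hd a).hasGradientAt
  have hcomp : HasDerivAt (fun s : ℝ => f (a + s • (b - a))) ⟪gradient f a, b - a⟫ 0 := by
    simpa using hg.comp_hasDerivWithinAt (s := univ) hline.hasDerivWithinAt
  have hconv : ConvexOn ℝ univ fun s : ℝ => f (a + s • (b - a)) := by
    have := hf.comp_affineMap (AffineMap.lineMap (k := ℝ) a b)
    refine (this.congr fun s _ => ?_)
    simp [AffineMap.lineMap_apply, add_comm]
  have := hconv.le_slope_of_hasDerivAt (mem_univ 0) (mem_univ 1) one_pos hcomp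
  simp only [slope_def_field, one_smul, zero_smul, add_sub_cancel, add_zero, sub_zero, div_one]
    at this
  linarith

/-- First-order optimality condition on a convex set. -/
theorem inner_gradient_nonneg_of_isMinOn {f : H → ℝ} {s : Set H} {z y : H} (hs : Convex ℝ s)
    (hd : DifferentiableAt ℝ f z) (hz : z ∈ s) (hy : y ∈ s) (hmin : IsMinOn f s z) :
    0 ≤ ⟪gradient f z, y - z⟫ := by
  have := hmin.localize.hasFDerivWithinAt_nonneg
    hd.hasGradientAt.hasFDerivAt.hasFDerivWithinAt
    (sub_mem_posTangentConeAt_of_segment_subset (hs.segment_subset hz hy))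
  simpa using this

/-- A convex function is weakly lower semicontinuous (along any filter). -/
theorem ConvexOn.le_of_weak_tendsto {ι : Type*} {f : H → ℝ} (hf : ConvexOn ℝ univ f)
    (hd : Differentiable ℝ f) {l : Filter ι} [l.NeBot] {u : ι → H} {w : H} {b : ι → ℝ} {c : ℝ}
    (hu : ∀ y, Tendsto (fun i => ⟪u i, y⟫) l (nhds ⟪w, y⟫)) (hub : ∀ᶠ i in l, f (u i) ≤ b i)
    (hb : Tendsto b l (nhds c)) : f w ≤ c := by
  have hlim : Tendsto (fun i => f w + (⟪u i, gradient f w⟫ - ⟪w, gradient f w⟫)) l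
      (nhds (f w)) := by
    simpa using ((hu (gradient f w)).sub_const ⟪w, gradient f w⟫).const_add (f w)
  refine le_of_tendsto_of_tendsto hlim hb ?_
  filter_upwards [hub] with i hi
  have := hf.add_inner_gradient_le hd w (u i)
  rw [inner_sub_right, real_inner_comm, real_inner_comm w] at this
  exact this.trans hi

end Convexity

section Opial

variable {H : Type*} [NormedAddCommGroup H] [InnerProductSpace ℝ H] [CompleteSpace H]

theorem Ultrafilter.exists_weak_tendsto {ι : Type*} (U : Ultrafilter ι) {u : ι → H} {C : ℝ}
    (hC : ∀ᶠ i in (U : Filter ι), ‖u i‖ ≤ C) :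
    ∃ w : H, ∀ y, Tendsto (fun i => ⟪u i, y⟫) U (nhds ⟪w, y⟫) := by
  obtain ⟨f, -, hf⟩ := (WeakDual.isCompact_closedBall (0 : StrongDual ℝ H) C).ultrafilter_le_nhds
    (U.map fun i => StrongDual.toWeakDual (InnerProductSpace.toDual ℝ H (u i))) (by
      rw [le_principal_iff, Ultrafilter.coe_map, Filter.mem_map]
      filter_upwards [hC] with i hi
      simpa using hi)
  refine ⟨(InnerProductSpace.toDual ℝ H).symm (WeakDual.toStrongDual f), fun y => ?_⟩
  have := ((WeakDual.eval_continuous y).tendsto f).comp hf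
  rw [InnerProductSpace.toDual_symm_apply]
  exact this

/-- **Opial's lemma**, along an arbitrary filter. -/
theorem opial {ι : Type*} {l : Filter ι} [l.NeBot] {u : ι → H} {S : Set H} (hS : S.Nonempty)
    (hdist : ∀ z ∈ S, ∃ a, Tendsto (fun i => ‖u i - z‖ ^ 2) l (nhds a))
    (hcluster : ∀ (U : Ultrafilter ι) (w : H), ↑U ≤ l →
      (∀ y, Tendsto (fun i => ⟪u i, y⟫) U (nhds ⟪w, y⟫)) → w ∈ S) :
    ∃ w ∈ S, ∀ y, Tendsto (fun i => ⟪u i, y⟫) l (nhds ⟪w, y⟫) := by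
  obtain ⟨z, hz⟩ := hS
  obtain ⟨a, ha⟩ := hdist z hz
  have hbdd : ∀ᶠ i in l, ‖u i‖ ≤ √(a + 1) + ‖z‖ := by
    filter_upwards [ha.eventually_lt_const (lt_add_one a)] with i hi
    have h1 : ‖u i - z‖ ≤ √(a + 1) := Real.le_sqrt_of_sq_le hi.le
    linarith [norm_le_norm_sub_add (u i) z]
  have hexists (U : Ultrafilter ι) (hU : ↑U ≤ l) :
      ∃ w ∈ S, ∀ y, Tendsto (fun i => ⟪u i, y⟫) U (nhds ⟪w, y⟫) := by
    obtain ⟨w, hw⟩ := U.exists_weak_tendsto (hU hbdd)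
    exact ⟨w, hcluster U w hU hw, hw⟩
  have hunique {U₁ U₂ : Ultrafilter ι} {w₁ w₂ : H} (hU₁ : ↑U₁ ≤ l) (hU₂ : ↑U₂ ≤ l)
      (hw₁S : w₁ ∈ S) (hw₂S : w₂ ∈ S)
      (hw₁ : ∀ y, Tendsto (fun i => ⟪u i, y⟫) U₁ (nhds ⟪w₁, y⟫))
      (hw₂ : ∀ y, Tendsto (fun i => ⟪u i, y⟫) U₂ (nhds ⟪w₂, y⟫)) : w₁ = w₂ := by
    obtain ⟨a₁, ha₁⟩ := hdist w₁ hw₁S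
    obtain ⟨a₂, ha₂⟩ := hdist w₂ hw₂S
    have hlim : Tendsto (fun i => ⟪u i, w₁ - w₂⟫) l
        (nhds ((a₂ - a₁ + ‖w₁‖ ^ 2 - ‖w₂‖ ^ 2) / 2)) := by
      refine ((((ha₂.sub ha₁).add_const (‖w₁‖ ^ 2)).sub_const (‖w₂‖ ^ 2)).div_const 2).congr
        fun i => ?_
      rw [norm_sub_sq_real, norm_sub_sq_real, inner_sub_right]
      ring
    have h₁ := tendsto_nhds_unique (hw₁ (w₁ - w₂)) (hlim.mono_left hU₁)
    have h₂ := tendsto_nhds_unique (hw₂ (w₁ - w₂)) (hlim.mono_left hU₂)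
    rw [← sub_eq_zero, ← inner_self_eq_zero (𝕜 := ℝ), inner_sub_left, h₁, h₂, sub_self]
  obtain ⟨w, hwS, hw⟩ := hexists (Ultrafilter.of l) (Ultrafilter.of_le l)
  refine ⟨w, hwS, fun y => (tendsto_iff_ultrafilter _ _ _).2 fun U hU => ?_⟩
  obtain ⟨w', hw'S, hw'⟩ := hexists U hU
  rw [hunique (Ultrafilter.of_le l) hU hwS hw'S hw hw']
  exact hw' y

end Opial

section Trajectory

variable {H : Type*} [NormedAddCommGroup H] [InnerProductSpace ℝ H]

theorem exists_pos_quadratic_lower_bound {γ μ : ℝ} (hμ : 0 < μ) (hμγ : μ < γ) :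
    ∃ c > 0, ∀ u d : H, c * (‖u‖ ^ 2 + ‖d‖ ^ 2 / 2) ≤
      ‖u‖ ^ 2 / 2 + μ * (⟪u, d⟫ + γ * (‖d‖ ^ 2 / 2)) := by
  set s := (μ + γ) / 2 with hs
  have hs0 : 0 < s := by linarith
  have hμs : μ / s < 1 := (div_lt_one hs0).2 (by linarith)
  refine ⟨min ((1 - μ / s) / 2) (μ * (γ - s)),
    lt_min (by linarith) (mul_pos hμ (by linarith)), fun u d => ?_⟩
  have hsq : 0 ≤ ‖u‖ ^ 2 + 2 * s * ⟪u, d⟫ + s ^ 2 * ‖d‖ ^ 2 := by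
    have := norm_add_sq_real u (s • d)
    rw [real_inner_smul_right, norm_smul, mul_pow, Real.norm_eq_abs, sq_abs] at this
    linarith [sq_nonneg ‖u + s • d‖]
  have h1 := mul_nonneg (div_pos hμ (mul_pos two_pos hs0)).le hsq
  have h2 : μ / (2 * s) * (‖u‖ ^ 2 + 2 * s * ⟪u, d⟫ + s ^ 2 * ‖d‖ ^ 2) =
      μ / s * ‖u‖ ^ 2 / 2 + μ * ⟪u, d⟫ + μ * s * (‖d‖ ^ 2 / 2) := by
    field_simp
  have h3 := mul_le_mul_of_nonneg_right (min_le_left ((1 - μ / s) / 2) (μ * (γ - s)))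
    (sq_nonneg ‖u‖)
  have h4 := mul_le_mul_of_nonneg_right (min_le_right ((1 - μ / s) / 2) (μ * (γ - s)))
    (by positivity : 0 ≤ ‖d‖ ^ 2 / 2)
  linarith

variable [CompleteSpace H]

/-- Along a trajectory, the distance to any solution `z` of the hierarchical minimization problem
converges, and the energy relative to `z` has a nonpositive limit. -/
theorem trajectory_tendsto {φ ψ : H → ℝ} {γ k : ℝ} {β β' : ℝ → ℝ} {x x' x'' : ℝ → H} {z : H}
    (hψconv : ConvexOn ℝ univ ψ) (hψdiff : Differentiable ℝ ψ) (hψnonneg : ∀ y, 0 ≤ ψ y)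
    (hφconv : ConvexOn ℝ univ φ) (hφdiff : Differentiable ℝ φ) (hφbdd : BddBelow (range φ))
    (hγ : 0 < γ) (hk : 0 ≤ k) (hkγ : k < γ)
    (hβpos : ∀ t ∈ Ici (0 : ℝ), 0 < β t)
    (hβderiv : ∀ t ∈ Ici (0 : ℝ), HasDerivWithinAt β (β' t) (Ici 0) t)
    (hβgrowth : ∀ t ∈ Ici (0 : ℝ), β' t ≤ k * β t)
    (hH : ∀ p : H, (∀ y, ψ y = 0 → ⟪p, y - z⟫ ≤ 0) →
      ∫⁻ t in Ici (0 : ℝ), ⨆ w : H,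
        ENNReal.ofReal (β t * ((⟪(β t)⁻¹ • p, w⟫ - ψ w) - ⟪(β t)⁻¹ • p, z⟫)) ≠ ⊤)
    (hx' : ∀ t ∈ Ici (0 : ℝ), HasDerivWithinAt x (x' t) (Ici 0) t)
    (hx'' : ∀ t ∈ Ici (0 : ℝ), HasDerivWithinAt x' (x'' t) (Ici 0) t)
    (hode : ∀ t ∈ Ici (0 : ℝ),
      x'' t + γ • x' t + gradient φ (x t) + β t • gradient ψ (x t) = 0)
    (hz : ψ z = 0) (hzmin : ∀ y, ψ y = 0 → φ z ≤ φ y) :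
    (∃ a, Tendsto (fun t => ‖x t - z‖ ^ 2) atTop (nhds a)) ∧
      ∃ l ≤ 0, Tendsto (fun t => ‖x' t‖ ^ 2 / 2 + (φ (x t) - φ z) + β t * ψ (x t)) atTop
        (nhds l) := by
  set μ := (γ + k) / 2 with hμ
  set δ := (γ - k) / 2 with hδ
  have hμ0 : 0 < μ := by linarith
  have hδ0 : 0 < δ := by linarith
  have hμγ : μ < γ := by linarith
  have hargmin : Convex ℝ {y | ψ y = 0} := by
    have := hψconv.convex_le 0
    simpa [le_antisymm_iff, hψnonneg] using this
  set p := (μ / δ) • -gradient φ z with hp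
  have hpnormal : ∀ y, ψ y = 0 → ⟪p, y - z⟫ ≤ 0 := fun y hy => by
    have := inner_gradient_nonneg_of_isMinOn hargmin (hφdiff z) hz hy hzmin
    rw [hp, real_inner_smul_left, inner_neg_left]
    exact mul_nonpos_of_nonneg_of_nonpos (div_pos hμ0 hδ0).le (neg_nonpos.2 this)
  have hxc : ContinuousOn x (Ici 0) := fun t ht => (hx' t ht).continuousWithinAt
  have hx'c : ContinuousOn x' (Ici 0) := fun t ht => (hx'' t ht).continuousWithinAt
  have hβc : ContinuousOn β (Ici 0) := fun t ht => (hβderiv t ht).continuousWithinAt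
  have hψx : ContinuousOn (fun t => ψ (x t)) (Ici 0) := hψdiff.continuous.comp_continuousOn hxc
  obtain ⟨G, M, hG, hGM⟩ := exists_bounded_primitive
    (f := fun t => max (⟪p, x t - z⟫ - β t * ψ (x t)) 0)
    (((continuousOn_const.inner ((hxc.sub continuousOn_const))).sub (hβc.mul hψx)).sup
      continuousOn_const) (fun t _ => le_max_right _ _) (by
      refine ne_top_of_le_ne_top (hH p hpnormal) (setLIntegral_mono' measurableSet_Ici
        fun t ht => le_iSup_of_le (x t) ?_)
      rw [ENNReal.ofReal_max, ENNReal.ofReal_zero, max_eq_left zero_le]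
      refine ENNReal.ofReal_le_ofReal (le_of_eq ?_)
      have := (hβpos t ht).ne'
      rw [real_inner_smul_left p (x t), real_inner_smul_left p z, inner_sub_right]
      field_simp
      ring)
  obtain ⟨c, hc, hquad⟩ := exists_pos_quadratic_lower_bound (H := H) hμ0 hμγ
  obtain ⟨m, hm⟩ := hφbdd
  have hd : ∀ t ∈ Ici (0 : ℝ), HasDerivWithinAt (fun t => x t - z) (x' t) (Ici 0) t :=
    fun t ht => (hx' t ht).sub_const z
  have hh : ∀ t ∈ Ici (0 : ℝ),
      HasDerivWithinAt (fun t => ‖x t - z‖ ^ 2 / 2) ⟪x' t, x t - z⟫ (Ici 0) t := fun t ht => by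
    refine ((hd t ht).norm_sq.div_const 2).congr_deriv ?_
    rw [real_inner_comm]
    ring
  have hh' : ∀ t ∈ Ici (0 : ℝ), HasDerivWithinAt (fun t => ⟪x' t, x t - z⟫)
      (⟪x'' t, x t - z⟫ + ‖x' t‖ ^ 2) (Ici 0) t := fun t ht => by
    refine ((hx'' t ht).inner ℝ (hd t ht)).congr_deriv ?_
    rw [real_inner_self_eq_norm_sq, add_comm]
  have hW : ∀ t ∈ Ici (0 : ℝ),
      HasDerivWithinAt (fun t => ‖x' t‖ ^ 2 / 2 + (φ (x t) - φ z) + β t * ψ (x t))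
        (⟪x' t, x'' t⟫ + ⟪gradient φ (x t), x' t⟫
          + (β' t * ψ (x t) + β t * ⟪gradient ψ (x t), x' t⟫)) (Ici 0) t := fun t ht => by
    refine ((((hx'' t ht).norm_sq.div_const 2).add
      (((hφdiff _).hasGradientAt.comp_hasDerivWithinAt (hx' t ht)).sub_const (φ z))).add
      ((hβderiv t ht).mul
        ((hψdiff _).hasGradientAt.comp_hasDerivWithinAt (hx' t ht)))).congr_deriv ?_
    ring
  have hacc : ∀ t ∈ Ici (0 : ℝ),
      x'' t = -(γ • x' t) - gradient φ (x t) - β t • gradient ψ (x t) := fun t ht => by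
    rw [← sub_eq_zero, ← hode t ht]
    abel
  have hβψ : ∀ t ∈ Ici (0 : ℝ), 0 ≤ β t * ψ (x t) := fun t ht =>
    mul_nonneg (hβpos t ht).le (hψnonneg _)
  have hq : ∀ t ∈ Ici (0 : ℝ), ⟪x'' t, x t - z⟫ + ‖x' t‖ ^ 2 + γ * ⟪x' t, x t - z⟫ ≤
      ‖x' t‖ ^ 2 - (φ (x t) - φ z) - β t * ψ (x t) := fun t ht => by
    have h1 := hφconv.add_inner_gradient_le hφdiff (x t) z
    have h2 := mul_le_mul_of_nonneg_left (hψconv.add_inner_gradient_le hψdiff (x t) z)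
      (hβpos t ht).le
    rw [← neg_sub, inner_neg_right] at h1 h2
    rw [hz] at h2
    rw [hacc t ht, inner_sub_left, inner_sub_left, inner_neg_left, real_inner_smul_left,
      real_inner_smul_left]
    linarith
  have hopt : ∀ t, -(μ * (φ (x t) - φ z)) ≤ δ * ⟪p, x t - z⟫ := fun t => by
    have h1 := mul_le_mul_of_nonneg_left (hφconv.add_inner_gradient_le hφdiff z (x t)) hμ0.le
    rw [hp, real_inner_smul_left, inner_neg_left, ← mul_assoc, mul_div_cancel₀ _ hδ0.ne']
    linarith
  have hG' : ∀ t, δ * (⟪p, x t - z⟫ - β t * ψ (x t)) ≤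
      δ * max (⟪p, x t - z⟫ - β t * ψ (x t)) 0 := fun t =>
    mul_le_mul_of_nonneg_left (le_max_left _ _) hδ0.le
  obtain ⟨⟨l, hl⟩, hWlim⟩ := lyapunov_tendsto (v := fun t => ‖x' t‖ ^ 2) (m := m - φ z) hγ hμ0 hδ0
    hc hh hh' hW (fun t ht => (hG t ht).const_mul δ)
    (fun t ht => mul_le_mul_of_nonneg_left (hGM t ht) hδ0.le) (hx'c.norm.pow 2)
    (fun t _ => mul_nonneg hδ0.le (le_max_right _ _)) (fun t _ => sq_nonneg _)
    (fun t _ => by positivity)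
    (fun t _ => by
      have := norm_add_sq_real (x' t) (x t - z)
      nlinarith [sq_nonneg ‖x' t + (x t - z)‖, sq_nonneg ‖x' t‖])
    (fun t ht => by linarith [hq t ht])
    (fun t ht => by
      have h1 := mul_le_mul_of_nonneg_left (hq t ht) hμ0.le
      have h2 := mul_nonneg hk (hβψ t ht)
      have h3 : μ * (β t * ψ (x t)) = δ * (β t * ψ (x t)) + k * (β t * ψ (x t)) := by
        rw [hμ, hδ]; ring
      linarith [hopt t, hG' t])
    (fun t ht => by
      have h1 := mul_le_mul_of_nonneg_left (hq t ht) hμ0.le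
      have h2 := mul_le_mul_of_nonneg_right (hβgrowth t ht) (hψnonneg (x t))
      have h3 : μ * (β t * ψ (x t)) = δ * (β t * ψ (x t)) + k * (β t * ψ (x t)) := by
        rw [hμ, hδ]; ring
      have h4 : μ * ‖x' t‖ ^ 2 = γ * ‖x' t‖ ^ 2 - δ * ‖x' t‖ ^ 2 := by
        rw [hμ, hδ]; ring
      have h5 : ⟪x' t, x'' t⟫ + ⟪gradient φ (x t), x' t⟫ + β t * ⟪gradient ψ (x t), x' t⟫ =
          -(γ * ‖x' t‖ ^ 2) := by
        rw [hacc t ht, inner_sub_right, inner_sub_right, inner_neg_right, real_inner_smul_right,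
          real_inner_smul_right, real_inner_self_eq_norm_sq, real_inner_comm (x' t),
          real_inner_comm (x' t)]
        ring
      linarith [hopt t, hG' t])
    (fun t ht => by
      linarith [hquad (x' t) (x t - z), hm (mem_range_self (x t)), hβψ t ht])
  exact ⟨⟨l * 2, (hl.mul_const 2).congr fun t => by ring⟩, hWlim⟩

end Trajectory

theorem stmt12 {H : Type*} [NormedAddCommGroup H] [InnerProductSpace ℝ H] [CompleteSpace H]
    (φ ψ : H → ℝ) (γ k : ℝ) (β β' : ℝ → ℝ) (x x' x'' : ℝ → H)
    -- ψ is convex, Fréchet differentiable with Lipschitz continuous gradient,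
    -- nonnegative, and argmin ψ = ψ⁻¹(0) is nonempty
    (hψconv : ConvexOn ℝ univ ψ)
    (hψdiff : Differentiable ℝ ψ)
    (hψlip : ∃ L : NNReal, LipschitzWith L (gradient ψ))
    (hψnonneg : ∀ y, 0 ≤ ψ y)
    (hψmin : ∃ y, ψ y = 0)
    -- φ is convex, Fréchet differentiable with Lipschitz continuous gradient,
    -- bounded from below, and S = {z ∈ argmin ψ : φ z ≤ φ y ∀ y ∈ argmin ψ} is nonempty
    (hφconv : ConvexOn ℝ univ φ)
    (hφdiff : Differentiable ℝ φ)
    (hφlip : ∃ L : NNReal, LipschitzWith L (gradient φ))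
    (hφbdd : BddBelow (range φ))
    (hS : ∃ z : H, ψ z = 0 ∧ ∀ y, ψ y = 0 → φ z ≤ φ y)
    -- γ > 0, 0 ≤ k < γ, and β : [0,∞) → (0,∞) is a C¹ function (with derivative β')
    -- satisfying the growth condition 0 ≤ β' ≤ k β
    (hγ : 0 < γ) (hk : 0 ≤ k) (hkγ : k < γ)
    (hβpos : ∀ t ∈ Ici (0 : ℝ), 0 < β t)
    (hβderiv : ∀ t ∈ Ici (0 : ℝ), HasDerivWithinAt β (β' t) (Ici 0) t)
    (hβ'cont : ContinuousOn β' (Ici 0))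
    (hβgrowth : ∀ t ∈ Ici (0 : ℝ), 0 ≤ β' t ∧ β' t ≤ k * β t)
    -- condition (H): for every p in the range of the normal cone to argmin ψ (i.e.
    -- p ∈ N(z) for some z ∈ argmin ψ = ψ⁻¹(0)), the integral
    -- ∫_0^∞ β(t) [ψ*(p/β(t)) - σ(p/β(t))] dt is finite; here σ(p/β(t)) = ⟪p/β(t), z⟫
    -- since p ∈ N(z), and β(t)[ψ*(q) - ⟪q, z⟫] = ⨆ w, β(t)((⟪q, w⟫ - ψ w) - ⟪q, z⟫) ≥ 0.
    (hH : ∀ z p : H, ψ z = 0 → (∀ y, ψ y = 0 → ⟪p, y - z⟫ ≤ 0) →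
      ∫⁻ t in Ici (0 : ℝ), ⨆ w : H,
        ENNReal.ofReal (β t * ((⟪(β t)⁻¹ • p, w⟫ - ψ w) - ⟪(β t)⁻¹ • p, z⟫)) ≠ ⊤)
    -- x : [0,∞) → H is twice continuously differentiable (first derivative x',
    -- second derivative x'') and satisfies ẍ + γ ẋ + ∇φ(x) + β ∇ψ(x) = 0 on [0,∞)
    (hx' : ∀ t ∈ Ici (0 : ℝ), HasDerivWithinAt x (x' t) (Ici 0) t)
    (hx'' : ∀ t ∈ Ici (0 : ℝ), HasDerivWithinAt x' (x'' t) (Ici 0) t)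
    (hx''cont : ContinuousOn x'' (Ici 0))
    (hode : ∀ t ∈ Ici (0 : ℝ),
      x'' t + γ • x' t + gradient φ (x t) + β t • gradient ψ (x t) = 0)
    -- β(t) → +∞ as t → +∞
    (hβinf : Tendsto β atTop atTop) :
    ∃ w : H, (ψ w = 0 ∧ ∀ y, ψ y = 0 → φ w ≤ φ y) ∧
      ∀ y : H, Tendsto (fun t => ⟪x t, y⟫) atTop (nhds ⟪w, y⟫) := by
  have htraj {z : H} (hz : ψ z = 0) (hzmin : ∀ y, ψ y = 0 → φ z ≤ φ y) :=
    trajectory_tendsto hψconv hψdiff hψnonneg hφconv hφdiff hφbdd hγ hk hkγ hβpos hβderiv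
      (fun t ht => (hβgrowth t ht).2) (fun p hp => hH z p hz hp) hx' hx'' hode hz hzmin
  obtain ⟨z, hz, hzmin⟩ := hS
  obtain ⟨-, l, hl0, hl⟩ := htraj hz hzmin
  obtain ⟨m, hm⟩ := hφbdd
  have hψlim : ∀ᶠ t in atTop, ψ (x t) ≤ (l + 1 - (m - φ z)) / β t := by
    filter_upwards [hl.eventually_lt_const (lt_add_one l), eventually_ge_atTop 0] with t ht ht0
    rw [le_div_iff₀ (hβpos t ht0)]
    linarith [hm (mem_range_self (x t)), sq_nonneg ‖x' t‖]
  have hφlim : ∀ᶠ t in atTop,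
      φ (x t) ≤ ‖x' t‖ ^ 2 / 2 + (φ (x t) - φ z) + β t * ψ (x t) + φ z := by
    filter_upwards [eventually_ge_atTop 0] with t ht0
    linarith [mul_nonneg (hβpos t ht0).le (hψnonneg (x t)), sq_nonneg ‖x' t‖]
  refine opial (S := {w | ψ w = 0 ∧ ∀ y, ψ y = 0 → φ w ≤ φ y}) ⟨z, hz, hzmin⟩
    (fun w hw => (htraj hw.1 hw.2).1) fun U w hU hw => ?_
  have hψw : ψ w ≤ 0 := hψconv.le_of_weak_tendsto hψdiff hw (hU hψlim)
    ((hβinf.const_div_atTop _).mono_left hU)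
  have hφw : φ w ≤ l + φ z := hφconv.le_of_weak_tendsto hφdiff hw (hU hφlim)
    ((hl.add_const (φ z)).mono_left hU)
  exact ⟨le_antisymm hψw (hψnonneg w), fun y hy => by linarith [hzmin y hy]⟩
end

section
/- Under the stated hypotheses, and assuming additionally that β(t) → +∞ as t → +∞, the energy functional satisfies lim_{t→∞} E(t) = φ(z) for every z ∈ S, where E(t) = ½‖ẋ(t)‖² + φ(x(t)) + β(t) ψ(x(t)). -/
open Filter MeasureTheory Set RealInnerProductSpace

section Convex

variable {H : Type*} [NormedAddCommGroup H] [InnerProductSpace ℝ H] [CompleteSpace H]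

/-- First order optimality condition for a minimizer over a convex set. -/
theorem IsMinOn.inner_gradient_nonneg {f : H → ℝ} {s : Set H} {a b : H} (h : IsMinOn f s a)
    (hs : Convex ℝ s) (ha : a ∈ s) (hb : b ∈ s) (hd : DifferentiableAt ℝ f a) :
    0 ≤ ⟪gradient f a, b - a⟫ :=
  h.localize.hasFDerivWithinAt_nonneg hd.hasGradientAt.hasFDerivAt.hasFDerivWithinAt
    (sub_mem_posTangentConeAt_of_segment_subset (hs.segment_subset ha hb))

theorem HasDerivAt.comp_gradient {f : H → ℝ} {x : ℝ → H} {v : H} {t : ℝ}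
    (hf : DifferentiableAt ℝ f (x t)) (hx : HasDerivAt x v t) :
    HasDerivAt (fun s => f (x s)) ⟪gradient f (x t), v⟫ t :=
  hf.hasGradientAt.hasFDerivAt.comp_hasDerivAt t hx

end Convex

/-- A function with nonpositive derivative is antitone on a half-line. -/
theorem antitoneOn_Ici_of_hasDerivAt_nonpos {f f' : ℝ → ℝ} {a : ℝ}
    (hf : ∀ t ≥ a, HasDerivAt f (f' t) t) (hf' : ∀ t ≥ a, f' t ≤ 0) :
    AntitoneOn f (Ici a) := by
  refine antitoneOn_of_deriv_nonpos (convex_Ici a)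
    (fun t ht => (hf t ht).continuousAt.continuousWithinAt)
    (fun t ht => (hf t (interior_subset ht)).differentiableAt.differentiableWithinAt)
    fun t ht => ?_
  rw [(hf t (interior_subset ht)).deriv]
  exact hf' t (interior_subset ht)

/-- A function bounded below with nonpositive derivative converges at infinity. -/
theorem exists_tendsto_of_hasDerivAt_nonpos {f f' : ℝ → ℝ} {a m : ℝ}
    (hf : ∀ t ≥ a, HasDerivAt f (f' t) t) (hf' : ∀ t ≥ a, f' t ≤ 0)
    (hm : ∀ t ≥ a, m ≤ f t) : ∃ l, Tendsto f atTop (nhds l) := by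
  have hanti := antitoneOn_Ici_of_hasDerivAt_nonpos hf hf'
  have hmax : Antitone fun t => f (max t a) := fun s t hst =>
    hanti (mem_Ici.2 (le_max_right _ _)) (mem_Ici.2 (le_max_right _ _)) (max_le_max_right a hst)
  have hbdd : BddBelow (range fun t => f (max t a)) :=
    ⟨m, by rintro _ ⟨t, rfl⟩; exact hm _ (le_max_right _ _)⟩
  refine ⟨_, (tendsto_atTop_ciInf hmax hbdd).congr' ?_⟩
  filter_upwards [eventually_ge_atTop a] with t ht
  rw [max_eq_left ht]

/-- If `f` converges at infinity, an upper bound of its derivative cannot have a negative limit. -/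
theorem nonneg_of_tendsto_of_hasDerivAt_le {f f' e : ℝ → ℝ} {a l c : ℝ}
    (hf : ∀ t ≥ a, HasDerivAt f (f' t) t) (hle : ∀ t ≥ a, f' t ≤ e t)
    (hl : Tendsto f atTop (nhds l)) (hc : Tendsto e atTop (nhds c)) : 0 ≤ c := by
  by_contra! hneg
  obtain ⟨T, hT⟩ := eventually_atTop.1
    ((hc.eventually_lt_const (show c < c / 2 by linarith)).and (eventually_ge_atTop a))
  have hanti : AntitoneOn (fun t => f t - c / 2 * t) (Ici T) := by
    refine antitoneOn_Ici_of_hasDerivAt_nonpos (f' := fun t => f' t - c / 2)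
      (fun t ht => ?_) fun t ht => ?_
    · exact ((hf t (hT t ht).2).sub ((hasDerivAt_id t).const_mul (c / 2))).congr_deriv (by simp)
    · linarith [hle t (hT t ht).2, (hT t ht).1]
  have hbot : Tendsto (fun t : ℝ => f T - c / 2 * T + c / 2 * t) atTop atBot :=
    tendsto_atBot_add_const_left _ _ (tendsto_id.const_mul_atTop_of_neg (by linarith))
  have hfbot : Tendsto f atTop atBot := by
    refine tendsto_atBot_mono' _ ?_ hbot
    filter_upwards [eventually_ge_atTop T] with t ht
    have := hanti self_mem_Ici ht ht
    dsimp only at this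
    linarith
  exact not_tendsto_nhds_of_tendsto_atBot hfbot l hl

/-- A continuous function whose positive part has finite integral on `[0, ∞)` admits a bounded
antiderivative of its positive part. -/
theorem exists_hasDerivAt_max_zero_bounded {f : ℝ → ℝ} (hf : ContinuousOn f (Ici 0))
    (hint : ∫⁻ t in Ici (0 : ℝ), ENNReal.ofReal (f t) ≠ ⊤) :
    ∃ (G : ℝ → ℝ) (B : ℝ), ∀ t > 0, HasDerivAt G (max (f t) 0) t ∧ 0 ≤ G t ∧ G t ≤ B := by
  set g : ℝ → ℝ := fun t => max (f (max t 0)) 0 with hg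
  have hgc : Continuous g :=
    (hf.comp_continuous (continuous_id.max continuous_const) fun t => mem_Ici.2 (le_max_right _ _)).max
      continuous_const
  have hg0 : ∀ t, 0 ≤ g t := fun t => le_max_right _ _
  have hgint : IntegrableOn g (Ici 0) := by
    refine ⟨hgc.aestronglyMeasurable, ?_⟩
    rw [hasFiniteIntegral_iff_ofReal (ae_of_all _ hg0)]
    refine lt_of_eq_of_lt (setLIntegral_congr_fun measurableSet_Ici fun t ht => ?_) hint.lt_top
    simp [hg, max_eq_left (mem_Ici.1 ht), ENNReal.ofReal_max]
  refine ⟨fun t => ∫ s in (0 : ℝ)..t, g s, ∫ s in Ici (0 : ℝ), g s, fun t ht => ⟨?_, ?_, ?_⟩⟩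
  · simpa [hg, max_eq_left ht.le] using (hgc.integral_hasStrictDerivAt 0 t).hasDerivAt
  · exact intervalIntegral.integral_nonneg ht.le fun s _ => hg0 s
  · dsimp only
    rw [intervalIntegral.integral_of_le ht.le]
    exact setIntegral_mono_set hgint (ae_of_all _ hg0)
      (Ioc_subset_Icc_self.trans Icc_subset_Ici_self).eventuallyLE

theorem stmt16 {H : Type*} [NormedAddCommGroup H] [InnerProductSpace ℝ H] [CompleteSpace H]
    (φ ψ : H → ℝ) (γ k : ℝ) (β β' : ℝ → ℝ) (x x' x'' : ℝ → H)
    -- ψ is convex, Fréchet differentiable with Lipschitz continuous gradient,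
    -- nonnegative, and argmin ψ = ψ⁻¹(0) is nonempty
    (hψconv : ConvexOn ℝ univ ψ)
    (hψdiff : Differentiable ℝ ψ)
    (hψlip : ∃ L : NNReal, LipschitzWith L (gradient ψ))
    (hψnonneg : ∀ y, 0 ≤ ψ y)
    (hψmin : ∃ y, ψ y = 0)
    -- φ is convex, Fréchet differentiable with Lipschitz continuous gradient,
    -- bounded from below, and S = {z ∈ argmin ψ : φ z ≤ φ y ∀ y ∈ argmin ψ} is nonempty
    (hφconv : ConvexOn ℝ univ φ)
    (hφdiff : Differentiable ℝ φ)
    (hφlip : ∃ L : NNReal, LipschitzWith L (gradient φ))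
    (hφbdd : BddBelow (range φ))
    (hS : ∃ z : H, ψ z = 0 ∧ ∀ y, ψ y = 0 → φ z ≤ φ y)
    -- γ > 0, 0 ≤ k < γ, and β : [0,∞) → (0,∞) is a C¹ function (with derivative β')
    -- satisfying the growth condition 0 ≤ β' ≤ k β
    (hγ : 0 < γ) (hk : 0 ≤ k) (hkγ : k < γ)
    (hβpos : ∀ t ∈ Ici (0 : ℝ), 0 < β t)
    (hβderiv : ∀ t ∈ Ici (0 : ℝ), HasDerivWithinAt β (β' t) (Ici 0) t)
    (hβ'cont : ContinuousOn β' (Ici 0))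
    (hβgrowth : ∀ t ∈ Ici (0 : ℝ), 0 ≤ β' t ∧ β' t ≤ k * β t)
    -- condition (H): for every p in the range of the normal cone to argmin ψ (i.e.
    -- p ∈ N(z) for some z ∈ argmin ψ = ψ⁻¹(0)), the integral
    -- ∫_0^∞ β(t) [ψ*(p/β(t)) - σ(p/β(t))] dt is finite; here σ(p/β(t)) = ⟪p/β(t), z⟫
    -- since p ∈ N(z), and β(t)[ψ*(q) - ⟪q, z⟫] = ⨆ w, β(t)((⟪q, w⟫ - ψ w) - ⟪q, z⟫) ≥ 0.
    (hH : ∀ z p : H, ψ z = 0 → (∀ y, ψ y = 0 → ⟪p, y - z⟫ ≤ 0) →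
      ∫⁻ t in Ici (0 : ℝ), ⨆ w : H,
        ENNReal.ofReal (β t * ((⟪(β t)⁻¹ • p, w⟫ - ψ w) - ⟪(β t)⁻¹ • p, z⟫)) ≠ ⊤)
    -- x : [0,∞) → H is twice continuously differentiable (first derivative x',
    -- second derivative x'') and satisfies ẍ + γ ẋ + ∇φ(x) + β ∇ψ(x) = 0 on [0,∞)
    (hx' : ∀ t ∈ Ici (0 : ℝ), HasDerivWithinAt x (x' t) (Ici 0) t)
    (hx'' : ∀ t ∈ Ici (0 : ℝ), HasDerivWithinAt x' (x'' t) (Ici 0) t)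
    (hx''cont : ContinuousOn x'' (Ici 0))
    (hode : ∀ t ∈ Ici (0 : ℝ),
      x'' t + γ • x' t + gradient φ (x t) + β t • gradient ψ (x t) = 0)
    -- β(t) → +∞ as t → +∞
    (hβinf : Tendsto β atTop atTop) :
    ∀ z : H, (ψ z = 0 ∧ ∀ y, ψ y = 0 → φ z ≤ φ y) →
      Tendsto (fun t => 1 / 2 * ‖x' t‖ ^ 2 + φ (x t) + β t * ψ (x t)) atTop (nhds (φ z)) := by
  rintro z ⟨hz, hzmin⟩
  obtain ⟨m, hlb⟩ := hφbdd
  have hm : ∀ y, m ≤ φ y := fun y => hlb ⟨y, rfl⟩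
  have hconvex : Convex ℝ {y | ψ y = 0} := by
    convert hψconv.convex_le 0 using 1
    ext y
    simpa using ⟨fun h => h.le, fun h => le_antisymm h (hψnonneg y)⟩
  have hopt : ∀ y, ψ y = 0 → 0 ≤ ⟪gradient φ z, y - z⟫ := fun y hy =>
    IsMinOn.inner_gradient_nonneg (fun w hw => hzmin w hw) hconvex hz hy (hφdiff z)
  -- weights of the Lyapunov function `E + lam • (ḣ + γ h)`, where `h = ‖x - z‖² / 2`
  obtain ⟨lam, hlam⟩ : ∃ lam, lam = (k + γ) / 2 := ⟨_, rfl⟩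
  obtain ⟨ε, hε⟩ : ∃ ε, ε = (γ - k) / 4 := ⟨_, rfl⟩
  obtain ⟨θ, hθ⟩ : ∃ θ, θ = ε / lam := ⟨_, rfl⟩
  have hlampos : 0 < lam := by linarith
  have hεpos : 0 < ε := by linarith
  have hθpos : 0 < θ := hθ ▸ div_pos hεpos hlampos
  have hθlam : lam * θ = ε := by rw [hθ]; field_simp
  have hθle : θ ≤ 1 := by rw [hθ, div_le_one hlampos]; linarith
  set p : H := -(θ⁻¹ • gradient φ z) with hp
  have hpinner : ∀ u, θ * ⟪p, u⟫ = -⟪gradient φ z, u⟫ := fun u => by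
    rw [hp, inner_neg_left, real_inner_smul_left]
    field_simp
  have hpcone : ∀ y, ψ y = 0 → ⟪p, y - z⟫ ≤ 0 := fun y hy => by
    have := hpinner (y - z)
    nlinarith [hopt y hy]
  set g : ℝ → ℝ := fun t => ⟪p, x t - z⟫ - β t * ψ (x t) with hg
  have hxc : ContinuousOn x (Ici 0) := fun t ht => (hx' t ht).continuousWithinAt
  have hβc : ContinuousOn β (Ici 0) := fun t ht => (hβderiv t ht).continuousWithinAt
  have hgc : ContinuousOn g (Ici 0) :=
    (continuousOn_const.inner (hxc.sub continuousOn_const)).sub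
      (hβc.mul (hψdiff.continuous.comp_continuousOn hxc))
  have hgint : ∫⁻ t in Ici (0 : ℝ), ENNReal.ofReal (g t) ≠ ⊤ := by
    refine ne_top_of_le_ne_top (hH z p hz hpcone) (setLIntegral_mono' measurableSet_Ici ?_)
    intro t ht
    refine le_trans (le_of_eq ?_) (le_iSup _ (x t))
    have := (hβpos t ht).ne'
    rw [real_inner_smul_left, real_inner_smul_left, hg]
    congr 1
    simp only [inner_sub_right]
    field_simp
    ring
  obtain ⟨G, B, hG⟩ := exists_hasDerivAt_max_zero_bounded hgc hgint
  have hxd : ∀ t ≥ 1, HasDerivAt x (x' t) t := fun t ht =>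
    (hx' t (mem_Ici.2 (by linarith))).hasDerivAt (Ici_mem_nhds (by linarith))
  have hx'd : ∀ t ≥ 1, HasDerivAt x' (x'' t) t := fun t ht =>
    (hx'' t (mem_Ici.2 (by linarith))).hasDerivAt (Ici_mem_nhds (by linarith))
  have hβd : ∀ t ≥ 1, HasDerivAt β (β' t) t := fun t ht =>
    (hβderiv t (mem_Ici.2 (by linarith))).hasDerivAt (Ici_mem_nhds (by linarith))
  have hGd : ∀ t ≥ 1, HasDerivAt G (max (g t) 0) t := fun t ht => (hG t (by linarith)).1
  have hβψ : ∀ t ≥ 1, 0 ≤ β t * ψ (x t) := fun t ht =>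
    mul_nonneg (hβpos t (mem_Ici.2 (by linarith))).le (hψnonneg _)
  have hβ'ψ : ∀ t ≥ 1, β' t * ψ (x t) ≤ k * (β t * ψ (x t)) := fun t ht => by
    rw [← mul_assoc]
    exact mul_le_mul_of_nonneg_right (hβgrowth t (mem_Ici.2 (by linarith))).2 (hψnonneg _)
  have hx''eq : ∀ t ≥ 1, ∀ u, ⟪x'' t, u⟫ =
      -(γ * ⟪x' t, u⟫) - ⟪gradient φ (x t), u⟫ - β t * ⟪gradient ψ (x t), u⟫ := by
    intro t ht u
    have := congrArg (fun v => ⟪v, u⟫) (hode t (mem_Ici.2 (by linarith)))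
    simp only [inner_add_left, real_inner_smul_left, inner_zero_left] at this
    linarith
  set E : ℝ → ℝ := fun t => 1 / 2 * ‖x' t‖ ^ 2 + φ (x t) + β t * ψ (x t) with hE
  set W : ℝ → ℝ := fun t => ⟪x' t, x t - z⟫ + γ / 2 * ‖x t - z‖ ^ 2 with hW
  have hEd : ∀ t ≥ 1, HasDerivAt E (-(γ * ‖x' t‖ ^ 2) + β' t * ψ (x t)) t := by
    intro t ht
    refine ((((hx'd t ht).norm_sq.const_mul (1 / 2)).add
      (HasDerivAt.comp_gradient (hφdiff _) (hxd t ht))).add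
      ((hβd t ht).mul (HasDerivAt.comp_gradient (hψdiff _) (hxd t ht)))).congr_deriv ?_
    rw [real_inner_comm (x'' t), hx''eq t ht, real_inner_self_eq_norm_sq]
    ring
  obtain ⟨W', hW'⟩ : ∃ W' : ℝ → ℝ, ∀ t, W' t = ‖x' t‖ ^ 2 - ⟪gradient φ (x t), x t - z⟫
      - β t * ⟪gradient ψ (x t), x t - z⟫ := ⟨_, fun _ => rfl⟩
  have hWd : ∀ t ≥ 1, HasDerivAt W (W' t) t := by
    intro t ht
    have hsub := (hxd t ht).sub_const z
    refine (((hx'd t ht).inner ℝ hsub).add (hsub.norm_sq.const_mul (γ / 2))).congr_deriv ?_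
    rw [hW', hx''eq t ht, real_inner_self_eq_norm_sq, real_inner_comm (x' t) (x t - z)]
    ring
  have hW'le : ∀ t ≥ 1, W' t ≤ ‖x' t‖ ^ 2 + φ z - φ (x t) - β t * ψ (x t) := by
    intro t ht
    have h1 := hφconv.add_inner_gradient_le hφdiff (x t) z
    have h2 := mul_le_mul_of_nonneg_left (hψconv.add_inner_gradient_le hψdiff (x t) z)
      (hβpos t (mem_Ici.2 (by linarith))).le
    rw [← neg_sub (x t) z, inner_neg_right] at h1 h2
    rw [hz] at h2
    rw [hW']
    linarith
  have hφge : ∀ t, φ z - θ * max (g t) 0 - θ * (β t * ψ (x t)) ≤ φ (x t) := by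
    intro t
    have h1 := hφconv.add_inner_gradient_le hφdiff z (x t)
    have h2 := mul_le_mul_of_nonneg_left (le_max_left (g t) 0) hθpos.le
    have h3 := hpinner (x t - z)
    simp only [hg, mul_sub] at h2
    linarith
  have hlyap : ∀ t ≥ 1, -(γ * ‖x' t‖ ^ 2) + β' t * ψ (x t) + lam * W' t - ε * max (g t) 0
      ≤ -ε * (‖x' t‖ ^ 2 + β t * ψ (x t)) := by
    intro t ht
    have h1 := mul_le_mul_of_nonneg_left ((hW'le t ht).trans
      (show _ ≤ ‖x' t‖ ^ 2 + θ * max (g t) 0 + θ * (β t * ψ (x t)) - β t * ψ (x t) by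
        linarith [hφge t])) hlampos.le
    have h2 : lam * (‖x' t‖ ^ 2 + θ * max (g t) 0 + θ * (β t * ψ (x t)) - β t * ψ (x t)) =
        lam * ‖x' t‖ ^ 2 + ε * max (g t) 0 + (ε - lam) * (β t * ψ (x t)) := by
      rw [← hθlam]; ring
    have h3 := hβ'ψ t ht
    have h4 : 0 ≤ ε * ‖x' t‖ ^ 2 := by positivity
    have h5 : lam = γ - 2 * ε := by linarith
    have h6 : k = γ - 4 * ε := by linarith
    rw [h2, h5] at h1
    rw [h6] at h3
    rw [h5]
    linarith
  have hVd : ∀ t ≥ 1, HasDerivAt (fun s => E s + lam * W s - ε * G s)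
      (-(γ * ‖x' t‖ ^ 2) + β' t * ψ (x t) + lam * W' t - ε * max (g t) 0) t := fun t ht =>
    ((hEd t ht).add ((hWd t ht).const_mul lam)).sub ((hGd t ht).const_mul ε)
  have hEge : ∀ t ≥ 1, m ≤ E t := fun t ht => by
    have h1 := hm (x t)
    have h2 := hβψ t ht
    have h3 := sq_nonneg ‖x' t‖
    simp only [hE]
    linarith
  have hVge : ∀ t ≥ 1, m - ε * B ≤ E t + lam * W t - ε * G t := by
    intro t ht
    have h1 := hm (x t)
    have h2 := hβψ t ht
    have h3 : 0 ≤ ‖x' t + lam • (x t - z)‖ ^ 2 := sq_nonneg _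
    rw [norm_add_sq_real, real_inner_smul_right, norm_smul, mul_pow, Real.norm_eq_abs,
      sq_abs] at h3
    have h4 := mul_le_mul_of_nonneg_left (hG t (by linarith)).2.2 hεpos.le
    have h5 : 0 ≤ lam * (γ - lam) * ‖x t - z‖ ^ 2 :=
      mul_nonneg (mul_nonneg hlampos.le (by linarith)) (sq_nonneg _)
    simp only [hE, hW]
    linarith
  have hdiss : ∀ t ≥ 1, 0 ≤ ε * (‖x' t‖ ^ 2 + β t * ψ (x t)) := fun t ht =>
    mul_nonneg hεpos.le (add_nonneg (sq_nonneg _) (hβψ t ht))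
  obtain ⟨lV, hlV⟩ := exists_tendsto_of_hasDerivAt_nonpos hVd
    (fun t ht => by linarith [hlyap t ht, hdiss t ht]) hVge
  obtain ⟨lG, hlG⟩ := exists_tendsto_of_hasDerivAt_nonpos (m := -B)
    (fun t ht => (hGd t ht).neg) (fun t _ => neg_nonpos.2 (le_max_right _ _))
    (fun t ht => neg_le_neg (hG t (by linarith)).2.2)
  obtain ⟨lU, hlU⟩ := exists_tendsto_of_hasDerivAt_nonpos (m := ε * m + k * (m - ε * B))
    (fun t ht => ((hEd t ht).const_mul ε).add ((hVd t ht).const_mul k))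
    (fun t ht => by
      have h1 := mul_le_mul_of_nonneg_left (hlyap t ht) hk
      have h2 := mul_le_mul_of_nonneg_left (hβ'ψ t ht) hεpos.le
      have h3 : 0 ≤ ε * (γ * ‖x' t‖ ^ 2) := by positivity
      have h4 : 0 ≤ k * (ε * ‖x' t‖ ^ 2) := by positivity
      linarith)
    (fun t ht => add_le_add (mul_le_mul_of_nonneg_left (hEge t ht) hεpos.le)
      (mul_le_mul_of_nonneg_left (hVge t ht) hk))
  obtain ⟨l, hl⟩ : ∃ l, Tendsto E atTop (nhds l) := by
    refine ⟨ε⁻¹ * (lU - k * lV), ((hlU.sub (hlV.const_mul k)).const_mul ε⁻¹).congr fun t => ?_⟩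
    simp only [Pi.add_apply]
    field_simp
    ring
  obtain ⟨lW, hlW⟩ : ∃ l, Tendsto W atTop (nhds l) := by
    refine ⟨lam⁻¹ * (lV - l - ε * lG),
      (((hlV.sub hl).sub (hlG.const_mul ε)).const_mul lam⁻¹).congr fun t => ?_⟩
    simp only [Pi.neg_apply]
    field_simp
    ring
  have hupper : 0 ≤ φ z - l := by
    refine nonneg_of_tendsto_of_hasDerivAt_le
      (fun t ht => (hWd t ht).add ((hVd t ht).const_mul (3 / 2 * ε⁻¹))) (fun t ht => ?_)
      (hlW.add (hlV.const_mul _)) (hl.const_sub (φ z))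
    have h1 := mul_le_mul_of_nonneg_left (hlyap t ht) (show 0 ≤ 3 / 2 * ε⁻¹ by positivity)
    have h2 : 3 / 2 * ε⁻¹ * (-ε * (‖x' t‖ ^ 2 + β t * ψ (x t))) =
        -(3 / 2 * (‖x' t‖ ^ 2 + β t * ψ (x t))) := by field_simp
    have h3 := hW'le t ht
    have h4 := hβψ t ht
    simp only [hE]
    linarith
  have hlower : 0 ≤ l - φ z := by
    refine nonneg_of_tendsto_of_hasDerivAt_le
      (fun t ht => (hGd t ht).neg.const_mul θ) (fun t ht => ?_)
      (hlG.const_mul θ) (hl.sub_const (φ z))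
    have h1 := hφge t
    have h2 := mul_le_mul_of_nonneg_right hθle (hβψ t ht)
    have h3 := sq_nonneg ‖x' t‖
    simp only [hE]
    linarith
  rwa [le_antisymm (sub_nonneg.1 hupper) (sub_nonneg.1 hlower)] at hl
end
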